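/- arXiv:2512.08519 — 2 statements merged into one kernel-verified Lean document; each statement's English description precedes it below -/
import Mathlib

section
/- Let X₁, …, X_k be bilateral Fréchet sequence spaces (infinite-dimensional separable Fréchet spaces embedding continuously and injectively into the product space 𝕂^ℤ, 𝕂 = ℝ or ℂ) in which the coordinate unit vectors (e_n)_{n∈ℤ} form a basis, meaning that each e_n lies in X_i and for every x ∈ X_i the symmetric partial sums ∑_{|n|≤m} x_n e_n converge to x as m → ∞. Let B_i : X_i → X_i be the backward shift, (B_i x)_n = x_{n+1}, assumed to map X_i into X_i (hence continuous). Let F be a Furstenberg family. Then the following are equivalent: (1) B₁ ⊕ … ⊕ B_k is F-transitive; (2) B₁ ⊕ … ⊕ B_k is F-mixing; (3) B₁ ⊕ … ⊕ B_k satisfies the F-Mixing Criterion, i.e. there are dense subsets X₀, Y₀ of ⊕X_i and maps S_n : Y₀ → ⊕X_i with F-lim_{n→∞} (T^n x₀, S_n y₀, T^n S_n y₀) = (0,0,y₀) for all x₀ ∈ X₀, y₀ ∈ Y₀, where T = ⊕B_i; (4) for every N ∈ ℕ and every choice of neighborhoods W_i of 0 in X_i (1 ≤ i ≤ k), the set {n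 ∈ ℕ : e_{j+n} ∈ W_i and e_{j−n} ∈ W_i for all j with |j| ≤ N and all 1 ≤ i ≤ k} belongs to F. -/
open Set Topology Function Filter
open scoped ENNReal

/- ### Basic dynamical notions -/

/-- The return time set `N(U,V) = {n ∈ ℕ : T^n(U) ∩ V ≠ ∅}`. -/
def nset {X : Type*} (T : X → X) (U V : Set X) : Set ℕ :=
  {n : ℕ | ∃ x ∈ U, T^[n] x ∈ V}

/-- A Furstenberg family: nonempty, hereditary upward, not containing `∅`. -/
def IsFamily (F : Set (Set ℕ)) : Prop :=
  F.Nonempty ∧ (∀ ⦃A B : Set ℕ⦄, A ∈ F → A ⊆ B → B ∈ F) ∧ ∅ ∉ F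

/-- `T` is `F`-transitive. -/
def FTrans {X : Type*} [TopologicalSpace X] (T : X → X) (F : Set (Set ℕ)) : Prop :=
  ∀ U V : Set X, IsOpen U → IsOpen V → U.Nonempty → V.Nonempty → nset T U V ∈ F

/-- Direct sum (product) of two maps. -/
def prodMap' {X Y : Type*} (T : X → X) (S : Y → Y) : X × Y → X × Y :=
  fun p => (T p.1, S p.2)

/-- `T` is `F`-mixing: `T × T` is `F`-transitive. -/
def FMix {X : Type*} [TopologicalSpace X] (T : X → X) (F : Set (Set ℕ)) : Prop :=
  FTrans (prodMap' T T) F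

/-- Topological transitivity. -/
def TopTrans {X : Type*} [TopologicalSpace X] (T : X → X) : Prop :=
  ∀ U V : Set X, IsOpen U → IsOpen V → U.Nonempty → V.Nonempty → (nset T U V).Nonempty

/-- Weak mixing: `T × T` is topologically transitive. -/
def WMix {X : Type*} [TopologicalSpace X] (T : X → X) : Prop :=
  TopTrans (prodMap' T T)

/-- Hypercyclicity: some point has dense orbit. -/
def HypercyclicMap {X : Type*} [TopologicalSpace X] (T : X → X) : Prop :=
  ∃ x : X, Dense (Set.range fun n : ℕ => T^[n] x)

/-- Weak disjointness: the direct sum is hypercyclic. -/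
def WeaklyDisjoint {X Y : Type*} [TopologicalSpace X] [TopologicalSpace Y]
    (T : X → X) (S : Y → Y) : Prop :=
  HypercyclicMap (prodMap' T S)

/-- The family generated by the return time sets of `T`. -/
def NTfam {X : Type*} [TopologicalSpace X] (T : X → X) : Set (Set ℕ) :=
  {A : Set ℕ | ∃ U V : Set X, IsOpen U ∧ IsOpen V ∧ U.Nonempty ∧ V.Nonempty ∧ nset T U V ⊆ A}

/- ### Combinatorial families -/

/-- `(A + i) ∩ ℕ` for `i : ℤ`. -/
def shiftSet (A : Set ℕ) (i : ℤ) : Set ℕ := {n : ℕ | ∃ m ∈ A, (n : ℤ) = (m : ℤ) + i}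

/-- A shift-invariant family. -/
def ShiftInvariant (F : Set (Set ℕ)) : Prop := ∀ A ∈ F, ∀ i : ℤ, shiftSet A i ∈ F

/-- A shift₊-invariant family: `A + i ∈ F` for `i : ℕ`. -/
def ShiftPlusInvariant (F : Set (Set ℕ)) : Prop :=
  ∀ A ∈ F, ∀ i : ℕ, (fun n => n + i) '' A ∈ F

/-- A thick family: `⋂_{i=0}^{k} ((A - i) ∩ ℕ) ∈ F` for all `A ∈ F`, `k ∈ ℕ`. -/
def ThickFamily (F : Set (Set ℕ)) : Prop :=
  ∀ A ∈ F, ∀ k : ℕ, {n : ℕ | ∀ i ≤ k, n + i ∈ A} ∈ F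

/-- The dual family `F*`. -/
def dualFam (F : Set (Set ℕ)) : Set (Set ℕ) := {A | ∀ B ∈ F, (A ∩ B).Nonempty}

/-- A full family. -/
def FullFamily (F : Set (Set ℕ)) : Prop :=
  ∀ A ∈ F, ∀ B ∈ dualFam F, (A ∩ B).Infinite

/-- `F̃`: the members `A` of `F` with `⋂_{i=-k}^{k} ((A + i) ∩ ℕ) ∈ F` for all `k ∈ ℕ`. -/
def tildeFam (F : Set (Set ℕ)) : Set (Set ℕ) :=
  {A ∈ F | ∀ k : ℕ, {n : ℕ | ∀ i : ℤ, |i| ≤ (k : ℤ) → n ∈ shiftSet A i} ∈ F}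

/-- A thick subset of `ℕ`: contains arbitrarily long blocks of consecutive integers. -/
def IsThickSet (A : Set ℕ) : Prop := ∀ k : ℕ, ∃ n : ℕ, ∀ i ≤ k, n + i ∈ A

/-- A syndetic subset of `ℕ` (bounded gaps). -/
def IsSyndetic (A : Set ℕ) : Prop := ∃ g : ℕ, ∀ n : ℕ, ∃ m ∈ A, n ≤ m ∧ m ≤ n + g

/-- A piecewise syndetic subset: intersection of a syndetic and a thick set. -/
def IsPiecewiseSyndetic (A : Set ℕ) : Prop :=
  ∃ S T : Set ℕ, IsSyndetic S ∧ IsThickSet T ∧ A = S ∩ T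

/-- An IP-set. -/
def IsIPSet (A : Set ℕ) : Prop :=
  ∃ x : ℕ → ℕ, {n | x n ≠ 0}.Infinite ∧ ∀ s : Finset ℕ, s.Nonempty → (∑ i ∈ s, x i) ∈ A

/-- `(A - A) ∩ ℕ` for `A ⊆ ℕ`: positive differences of distinct elements. -/
def diffSet (A : Set ℕ) : Set ℕ := {k | ∃ m ∈ A, ∃ n ∈ A, n < m ∧ k = m - n}

/-- The family `Δ*_ip`. -/
def deltaIPStar : Set (Set ℕ) :=
  {A | ∀ F : Set ℕ, IsIPSet F → (A ∩ diffSet F).Nonempty}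

/- ### Operators on Fréchet spaces -/

/-- A (continuous linear) operator on an infinite-dimensional separable Fréchet space
(a complete metrizable locally convex topological vector space) over `ℝ` or `ℂ`
(an `RCLike` field). -/
structure FrechetOp where
  𝕜 : Type
  [instField : RCLike 𝕜]
  X : Type
  [instAdd : AddCommGroup X]
  [instMod : Module 𝕜 X]
  [instUnif : UniformSpace X]
  [instUAG : IsUniformAddGroup X]
  [instSMul : ContinuousSMul 𝕜 X]
  [instComplete : CompleteSpace X]
  [instMetrizable : TopologicalSpace.MetrizableSpace X]
  [instSeparable : TopologicalSpace.SeparableSpace X]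
  [instModR : Module ℝ X]
  [instTower : IsScalarTower ℝ 𝕜 X]
  [instLC : LocallyConvexSpace ℝ X]
  infDim : ¬ FiniteDimensional 𝕜 X
  T : X → X
  linear : IsLinearMap 𝕜 T
  cont : Continuous T

attribute [instance] FrechetOp.instAdd FrechetOp.instMod
  FrechetOp.instUnif FrechetOp.instUAG FrechetOp.instSMul FrechetOp.instComplete
  FrechetOp.instMetrizable FrechetOp.instSeparable FrechetOp.instModR
  FrechetOp.instTower FrechetOp.instLC

/-- A bundled Fréchet-space operator is hypercyclic. -/
def FrechetOp.Hypercyclic (S : FrechetOp) : Prop := HypercyclicMap S.T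

/-- A bundled Fréchet-space operator is invertible (a linear homeomorphism). -/
def FrechetOp.Invertible (S : FrechetOp) : Prop :=
  ∃ T' : S.X → S.X, Continuous T' ∧ (∀ x, T' (S.T x) = x) ∧ (∀ x, S.T (T' x) = x)

/-- Mild mixing: weakly disjoint from every hypercyclic operator
(on every infinite-dimensional separable Fréchet space). -/
def MildlyMixing {X : Type*} [TopologicalSpace X] (T : X → X) : Prop :=
  ∀ S : FrechetOp, S.Hypercyclic → WeaklyDisjoint T S.T

/-- Topological ergodicity: all return time sets are syndetic. -/
def TopErgodic {X : Type*} [TopologicalSpace X] (T : X → X) : Prop :=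
  ∀ U V : Set X, IsOpen U → IsOpen V → U.Nonempty → V.Nonempty → IsSyndetic (nset T U V)

/-- The `F`-Mixing Criterion for a map `T`. -/
def FMixCriterion {X : Type*} [TopologicalSpace X] [Zero X] (T : X → X)
    (F : Set (Set ℕ)) : Prop :=
  ∃ X₀ Y₀ : Set X, Dense X₀ ∧ Dense Y₀ ∧ ∃ S : ℕ → X → X,
    ∀ x₀ ∈ X₀, ∀ y₀ ∈ Y₀, ∀ O ∈ nhds ((0, 0, y₀) : X × X × X),
      {n : ℕ | (T^[n] x₀, S n y₀, T^[n] (S n y₀)) ∈ O} ∈ F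

/- ### Bilateral weighted backward shifts on `ℓᵖ(ℤ)` and `c₀(ℤ)` -/

/-- `B` is the bilateral weighted backward shift with (positive, bounded) weight `w` on
`ℓᵖ(ℤ)`; the condition that `1/w` is bounded makes it invertible. -/
def IsInvertibleWBSlp (𝕜 : Type) [RCLike 𝕜] (p : ℝ≥0∞) [Fact (1 ≤ p)] (w : ℤ → ℝ)
    (B : lp (fun _ : ℤ => 𝕜) p →L[𝕜] lp (fun _ : ℤ => 𝕜) p) : Prop :=
  (∀ n, 0 < w n) ∧ (∃ C : ℝ, ∀ n, w n ≤ C) ∧ (∃ c : ℝ, 0 < c ∧ ∀ n, c ≤ w n) ∧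
    ∀ (x : lp (fun _ : ℤ => 𝕜) p) (n : ℤ), B x n = w (n + 1) • x (n + 1)

/-- `B` is the bilateral weighted backward shift with (positive, bounded) weight `w` on
`c₀(ℤ)`; the condition that `1/w` is bounded makes it invertible. -/
def IsInvertibleWBSc0 (𝕜 : Type) [RCLike 𝕜] (w : ℤ → ℝ)
    (B : ZeroAtInftyContinuousMap ℤ 𝕜 →L[𝕜] ZeroAtInftyContinuousMap ℤ 𝕜) : Prop :=
  (∀ n, 0 < w n) ∧ (∃ C : ℝ, ∀ n, w n ≤ C) ∧ (∃ c : ℝ, 0 < c ∧ ∀ n, c ≤ w n) ∧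
    ∀ (x : ZeroAtInftyContinuousMap ℤ 𝕜) (n : ℤ), B x n = w (n + 1) • x (n + 1)
set_option linter.unusedSectionVars false
section SingleSpace

open scoped ComplexOrder in
theorem aux_lc (𝕜 : Type) [RCLike 𝕜] (E : Type) [AddCommGroup E] [Module 𝕜 E]
    [TopologicalSpace E] [IsTopologicalAddGroup E] [ContinuousSMul 𝕜 E]
    [Module ℝ E] [IsScalarTower ℝ 𝕜 E] [LocallyConvexSpace ℝ E] : PolynormableSpace 𝕜 E := by
  have : ContinuousSMul ℝ E := IsScalarTower.continuousSMul 𝕜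
  have : LocallyConvexSpace 𝕜 E := by
    rw [locallyConvexSpace_iff_exists_convex_subset_zero]
    intro U hU
    obtain ⟨S, hS, hc, hSU⟩ :=
      (locallyConvexSpace_iff_exists_convex_subset_zero ℝ E).1 inferInstance U hU
    exact ⟨S, hS, convex_of_nonneg_surjective_algebraMap _
      (fun _ => RCLike.nonneg_iff_exists_ofReal.mp) hc, hSU⟩
  exact LocallyConvexSpace.toPolynormableSpace

variable {𝕜 : Type} [RCLike 𝕜] {X : Type}
    [AddCommGroup X] [Module 𝕜 X] [UniformSpace X]
    [IsUniformAddGroup X] [ContinuousSMul 𝕜 X] [CompleteSpace X]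
    [TopologicalSpace.MetrizableSpace X]
    [Module ℝ X] [IsScalarTower ℝ 𝕜 X] [LocallyConvexSpace ℝ X]
    (J : X →L[𝕜] (ℤ → 𝕜)) (e : ℤ → X)

/-- partial sum operators -/
noncomputable def auxS (m : ℕ) : X →L[𝕜] X :=
  ∑ n ∈ Finset.Ioo (-(m : ℤ)) m, ((ContinuousLinearMap.proj n).comp J).smulRight (e n)

theorem auxS_apply (m : ℕ) (x : X) :
    auxS J e m x = ∑ n ∈ Finset.Ioo (-(m : ℤ)) m, J x n • e n := by
  simp [auxS]

theorem auxJS (he : ∀ n, J (e n) = Pi.single n (1 : 𝕜)) (m : ℕ) (x : X) (k : ℤ) :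
    J (auxS J e m x) k = if |k| < m then J x k else 0 := by
  rw [auxS_apply]
  simp [he, Finset.sum_apply, Pi.single_apply, abs_lt]

theorem aux_equi
    (hbasis : ∀ x : X,
      Filter.Tendsto (fun m : ℕ => ∑ n ∈ Finset.Icc (-(m : ℤ)) (m : ℤ), (J x n) • e n)
        Filter.atTop (nhds x)) (W : Set X) (hW : W ∈ 𝓝 (0 : X)) :
    ∃ V ∈ 𝓝 (0 : X), ∀ x ∈ V, ∀ m, auxS J e m x ∈ W := by
  have : (uniformity X).IsCountablyGenerated := IsUniformAddGroup.uniformity_countably_generated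
  have : PolynormableSpace 𝕜 X := aux_lc 𝕜 X
  have h : ∀ x, Tendsto (fun m => auxS J e m x) atTop (𝓝 x) := by
    intro x
    rw [← tendsto_add_atTop_iff_nat 1]
    refine (hbasis x).congr fun m => ?_
    rw [auxS_apply]
    congr 1
    ext a
    simp only [Finset.mem_Icc, Finset.mem_Ioo]
    push_cast
    omega
  have hu : UniformEquicontinuous ((↑) ∘ auxS J e) :=
    PolynormableSpace.banach_steinhaus (𝕜₁ := 𝕜) (𝕜₂ := 𝕜)
      fun x => (h x).isVonNBounded_range 𝕜
  have h0 := hu.equicontinuous 0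
  have hU : {p : X × X | p.2 - p.1 ∈ W} ∈ uniformity X := by
    rw [uniformity_eq_comap_nhds_zero X]
    exact ⟨W, hW, fun p hp => hp⟩
  refine ⟨_, h0 _ hU, fun x hx m => ?_⟩
  have := hx m
  simpa using this

theorem aux_equiP
    (hbasis : ∀ x : X,
      Filter.Tendsto (fun m : ℕ => ∑ n ∈ Finset.Icc (-(m : ℤ)) (m : ℤ), (J x n) • e n)
        Filter.atTop (nhds x)) (W : Set X) (hW : W ∈ 𝓝 (0 : X)) :
    ∃ V ∈ 𝓝 (0 : X), ∀ x ∈ V, ∀ m, auxS J e (m+1) x - auxS J e m x ∈ W := by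
  have : Tendsto (fun p : X × X => p.1 - p.2) (𝓝 0 ×ˢ 𝓝 0) (𝓝 (0 : X)) := by
    rw [← nhds_prod_eq]
    have : Continuous (fun p : X × X => p.1 - p.2) := by fun_prop
    simpa using this.tendsto (0, 0)
  obtain ⟨A, hA, hAW⟩ := Filter.mem_prod_self_iff.1 (this hW)
  obtain ⟨V, hV, h⟩ := aux_equi J e hbasis A hA
  exact ⟨V, hV, fun x hx m => hAW (Set.mk_mem_prod (h x hx _) (h x hx _))⟩

/-- Equicontinuity of `x ↦ x_m e_{m-1}`. -/
theorem aux_equiE (hJinj : Function.Injective J)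
    (he : ∀ n, J (e n) = Pi.single n (1 : 𝕜))
    (hbasis : ∀ x : X,
      Filter.Tendsto (fun m : ℕ => ∑ n ∈ Finset.Icc (-(m : ℤ)) (m : ℤ), (J x n) • e n)
        Filter.atTop (nhds x))
    (B : X → X) (hB : ∀ (x : X) (n : ℤ), J (B x) n = J x (n + 1))
    (hBcont : Continuous B)
    (W : Set X) (hW : W ∈ 𝓝 (0 : X)) :
    ∃ V ∈ 𝓝 (0 : X), ∀ x ∈ V, ∀ m : ℤ, m ≠ 0 → J x m • e (m - 1) ∈ W := by
  have hB0 : B 0 = 0 := hJinj (by ext n; simp [hB])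
  obtain ⟨V1, hV1, h1⟩ := aux_equiP J e hbasis W hW
  have hV2 : B ⁻¹' V1 ∈ 𝓝 (0 : X) := hBcont.continuousAt (by rwa [hB0])
  obtain ⟨V3, hV3, h3⟩ := aux_equiP J e hbasis _ hV2
  refine ⟨V3, hV3, fun x hx m hm => ?_⟩
  have key := h1 _ (h3 x hx m.natAbs) (m - 1).natAbs
  convert key
  apply hJinj
  ext n
  simp only [map_smul, map_sub, Pi.smul_apply, Pi.sub_apply, he, auxJS J e he, hB,
    Pi.single_apply, smul_eq_mul, abs_lt]
  by_cases hn : n = m - 1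
  · subst hn
    have e1 : (-(((m-1).natAbs + 1 : ℕ) : ℤ) < m - 1 ∧ m - 1 < (((m-1).natAbs + 1 : ℕ) : ℤ)) := by
      omega
    have e2 : ¬ (-(((m-1).natAbs : ℕ) : ℤ) < m - 1 ∧ m - 1 < (((m-1).natAbs : ℕ) : ℤ)) := by
      omega
    have e3 : (-(((m).natAbs + 1 : ℕ) : ℤ) < m - 1 + 1 ∧ m - 1 + 1 < (((m).natAbs + 1 : ℕ) : ℤ)) := by
      omega
    have e4 : ¬ (-(((m).natAbs : ℕ) : ℤ) < m - 1 + 1 ∧ m - 1 + 1 < (((m).natAbs : ℕ) : ℤ)) := by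
      omega
    rw [if_pos e1, if_neg e2, if_pos e3, if_neg e4]
    simp
  · rw [if_neg hn]
    split_ifs <;> first | (exfalso; omega) | simp

theorem aux_iter (B : X → X) (hB : ∀ (x : X) (n : ℤ), J (B x) n = J x (n + 1))
    (n : ℕ) (x : X) (m : ℤ) : J (B^[n] x) m = J x (m + n) := by
  induction n generalizing x with
  | zero => simp
  | succ n ih => rw [Function.iterate_succ_apply, ih, hB]; push_cast; ring_nf

theorem aux_scale (W : Set X) (hW : W ∈ 𝓝 (0 : X)) :
    ∃ W' ∈ 𝓝 (0 : X), ∀ (c : 𝕜) (x : X), 1/2 ≤ ‖c‖ → c • x ∈ W' → x ∈ W := by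
  have h2 : (fun x : X => (2 : 𝕜) • x) ⁻¹' W ∈ 𝓝 (0 : X) := by
    have : Continuous (fun x : X => (2 : 𝕜) • x) := by fun_prop
    exact this.continuousAt (by simpa using hW)
  obtain ⟨W', ⟨hW', hb⟩, hs⟩ := (nhds_basis_balanced 𝕜 X).mem_iff.1 h2
  refine ⟨W', hW', fun c x hc hx => ?_⟩
  have hc0 : c ≠ 0 := by
    rintro rfl
    norm_num at hc
  have : ((2 : 𝕜)⁻¹ * c⁻¹) • (c • x) ∈ W' := by
    apply hb.smul_mem _ hx
    rw [norm_mul, norm_inv, norm_inv, RCLike.norm_ofNat]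
    have : 0 < ‖c‖ := norm_pos_iff.2 hc0
    rw [← mul_inv]
    apply inv_le_one_of_one_le₀
    linarith
  have := hs this
  simpa [smul_smul, hc0] using this

theorem aux_main (hJinj : Function.Injective J)
    (he : ∀ n, J (e n) = Pi.single n (1 : 𝕜))
    (hbasis : ∀ x : X,
      Filter.Tendsto (fun m : ℕ => ∑ n ∈ Finset.Icc (-(m : ℤ)) (m : ℤ), (J x n) • e n)
        Filter.atTop (nhds x))
    (B : X → X) (hB : ∀ (x : X) (n : ℤ), J (B x) n = J x (n + 1))
    (hBcont : Continuous B)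
    (N : ℕ) (W : Set X) (hW : W ∈ 𝓝 (0 : X)) :
    ∃ u v : X, ∃ A ∈ 𝓝 u, ∃ C ∈ 𝓝 v, ∀ n : ℕ, ∀ x ∈ A, B^[n] x ∈ C →
      ∀ j : ℤ, |j| ≤ (N : ℤ) → e (j + (n : ℤ)) ∈ W ∧ e (j - (n : ℤ)) ∈ W := by
  obtain ⟨W', hW', hsc⟩ := aux_scale (𝕜 := 𝕜) W hW
  obtain ⟨V, hV, hVW⟩ := aux_equiE J e hJinj he hbasis B hB hBcont W' hW'
  let s : X := ∑ n ∈ Finset.Ioo (-((N + 2 : ℕ) : ℤ)) (N + 2 : ℕ), e n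
  have hs : ∀ k : ℤ, J s k = if |k| < (N + 2 : ℕ) then 1 else 0 := by
    intro k
    simp only [s, map_sum, he, Finset.sum_apply, Pi.single_apply, Finset.sum_ite_eq,
      Finset.mem_Ioo, abs_lt]
  have gen : ∀ c : 𝕜, {x : X | x - c • s ∈ V ∧
      ∀ j ∈ Finset.Ioo (-((N + 2 : ℕ) : ℤ)) (N + 2 : ℕ), ‖J x j - c‖ < 1/2} ∈ 𝓝 (c • s) := by
    intro c
    refine Filter.inter_mem ?_ ?_
    · have : Continuous (fun x : X => x - c • s) := by fun_prop
      exact this.continuousAt (by simpa using hV)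
    · have : ∀ᶠ x in 𝓝 (c • s), ∀ j ∈ Finset.Ioo (-((N + 2 : ℕ) : ℤ)) (N + 2 : ℕ),
          ‖J x j - c‖ < 1/2 := by
        rw [Filter.eventually_all_finset]
        intro j hj
        have hc : Continuous (fun x : X => ‖J x j - c‖) :=
          ((continuous_apply j).comp J.continuous |>.sub continuous_const).norm
        refine hc.continuousAt.eventually_lt continuousAt_const ?_
        rw [Finset.mem_Ioo, ← abs_lt] at hj
        simp only [map_smul, Pi.smul_apply, hs, if_pos hj]
        simp
      exact this
  refine ⟨(1 : 𝕜) • s, (5 : 𝕜) • s, _, gen 1, _, gen 5, ?_⟩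
  rintro n x ⟨hx1, hx2⟩ ⟨hy1, hy2⟩ j hj
  have hn : (2 * N + 2 : ℤ) < n := by
    by_contra hcon
    have a1 := hx2 (n - (N + 1)) (by rw [Finset.mem_Ioo]; push_cast; omega)
    have a2 := hy2 (-(N + 1)) (by rw [Finset.mem_Ioo]; push_cast; omega)
    rw [aux_iter J B hB, show (-((N : ℤ) + 1) + n) = n - (N + 1) by ring] at a2
    have : ‖(4 : 𝕜)‖ < 1 := by
      calc ‖(4 : 𝕜)‖ = ‖(J x (n - (N + 1)) - 1) - (J x (n - (N + 1)) - 5)‖ := by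
            congr 1; ring
        _ ≤ _ := norm_sub_le _ _
        _ < 1 := by linarith
    rw [RCLike.norm_ofNat] at this
    norm_num at this
  rw [abs_le] at hj
  have big : ∀ (c : 𝕜) (a : 𝕜), 1 ≤ ‖c‖ → ‖a - c‖ < 1/2 → 1/2 ≤ ‖a‖ := by
    intro c a hc ha
    have := norm_sub_norm_le c a
    rw [norm_sub_rev] at this
    linarith
  constructor
  · have a1 := hVW _ hx1 (j + 1 + n) (by omega)
    have h0 : ¬ |j + 1 + (n : ℤ)| < (N + 2 : ℕ) := by rw [abs_lt]; push_cast; omega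
    simp only [map_sub, map_smul, Pi.sub_apply, Pi.smul_apply, hs, if_neg h0] at a1
    rw [smul_zero, sub_zero, show j + 1 + (n : ℤ) - 1 = j + n by ring] at a1
    refine hsc _ _ (big 5 _ ?_ ?_) a1
    · rw [RCLike.norm_ofNat]; norm_num
    · have := hy2 (j + 1) (by rw [Finset.mem_Ioo]; push_cast; omega)
      rwa [aux_iter J B hB] at this
  · have a1 := hVW _ hy1 (j + 1 - n) (by omega)
    have h0 : ¬ |j + 1 - (n : ℤ)| < (N + 2 : ℕ) := by rw [abs_lt]; push_cast; omega
    simp only [map_sub, map_smul, Pi.sub_apply, Pi.smul_apply, hs, if_neg h0,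
      aux_iter J B hB] at a1
    rw [smul_zero, sub_zero, show j + 1 - (n : ℤ) - 1 = j - n by ring,
      show j + 1 - (n : ℤ) + n = j + 1 by ring] at a1
    refine hsc _ _ (big 1 _ ?_ ?_) a1
    · simp
    · exact hx2 (j + 1) (by rw [Finset.mem_Ioo]; push_cast; omega)

/-- finitely supported vectors -/
def auxD : Set X := {x | ∃ m : ℕ, ∀ k : ℤ, (m : ℤ) < |k| → J x k = 0}

theorem auxD_dense
    (he : ∀ n, J (e n) = Pi.single n (1 : 𝕜))
    (hbasis : ∀ x : X,
      Filter.Tendsto (fun m : ℕ => ∑ n ∈ Finset.Icc (-(m : ℤ)) (m : ℤ), (J x n) • e n)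
        Filter.atTop (nhds x)) : Dense (auxD J) := by
  intro x
  refine mem_closure_of_tendsto (hbasis x) (Eventually.of_forall fun m => ⟨m, fun k hk => ?_⟩)
  have : ¬ (-(m : ℤ) ≤ k ∧ k ≤ m) := by rw [← abs_le]; omega
  simp [he, Finset.sum_apply, Pi.single_apply]
  intro h1 h2
  exact absurd ⟨h1, h2⟩ this

theorem auxD_eq (hJinj : Function.Injective J)
    (he : ∀ n, J (e n) = Pi.single n (1 : 𝕜)) (x : X) (m : ℕ)
    (hm : ∀ k : ℤ, (m : ℤ) < |k| → J x k = 0) :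
    x = ∑ n ∈ Finset.Icc (-(m : ℤ)) (m : ℤ), (J x n) • e n := by
  apply hJinj
  ext k
  simp only [map_sum, map_smul, he, Finset.sum_apply, Pi.smul_apply, Pi.single_apply,
    smul_eq_mul, mul_ite, mul_one, mul_zero, Finset.sum_ite_eq, Finset.mem_Icc]
  split_ifs with h
  · rfl
  · rw [← abs_le] at h
    exact hm k (by omega)

theorem aux_tendsto1 (hJinj : Function.Injective J)
    (he : ∀ n, J (e n) = Pi.single n (1 : 𝕜))
    (B : X → X) (hB : ∀ (x : X) (n : ℤ), J (B x) n = J x (n + 1))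
    (G : Filter ℕ) (hG : ∀ j : ℤ, Tendsto (fun n : ℕ => e (j - n)) G (𝓝 0))
    (x : X) (hx : x ∈ auxD J) : Tendsto (fun n => B^[n] x) G (𝓝 0) := by
  obtain ⟨m, hm⟩ := hx
  have h1 : ∀ n, B^[n] x = ∑ j ∈ Finset.Icc (-(m : ℤ)) (m : ℤ), (J x j) • e (j - n) := by
    intro n
    apply hJinj
    ext k
    rw [aux_iter J B hB]
    conv_lhs => rw [auxD_eq J e hJinj he x m hm]
    simp only [map_sum, map_smul, he, Finset.sum_apply, Pi.smul_apply, Pi.single_apply]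
    refine Finset.sum_congr rfl fun j _ => ?_
    congr 1
    exact if_congr (by omega) rfl rfl
  simp only [h1]
  have : Tendsto (fun n : ℕ => ∑ j ∈ Finset.Icc (-(m : ℤ)) (m : ℤ), (J x j) • e (j - n)) G
      (𝓝 (∑ j ∈ Finset.Icc (-(m : ℤ)) (m : ℤ), (J x j) • (0 : X))) :=
    tendsto_finsetSum _ fun j _ => (hG j).const_smul _
  simpa using this

/-- right inverse -/
noncomputable def auxR (n : ℕ) (y : X) : X := ∑ᶠ j : ℤ, J y j • e (j + n)

theorem auxR_eq (y : X) (m : ℕ)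
    (hm : ∀ k : ℤ, (m : ℤ) < |k| → J y k = 0) (n : ℕ) :
    auxR J e n y = ∑ j ∈ Finset.Icc (-(m : ℤ)) (m : ℤ), (J y j) • e (j + n) := by
  unfold auxR
  apply finsum_eq_sum_of_support_subset
  intro k hk
  rw [Finset.coe_Icc, Set.mem_Icc, ← abs_le]
  by_contra h
  apply hk
  simp [hm k (by omega)]

theorem aux_tendsto2 (G : Filter ℕ) (hG : ∀ j : ℤ, Tendsto (fun n : ℕ => e (j + n)) G (𝓝 0))
    (y : X) (hy : y ∈ auxD J) : Tendsto (fun n => auxR J e n y) G (𝓝 0) := by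
  obtain ⟨m, hm⟩ := hy
  simp only [auxR_eq J e y m hm]
  have : Tendsto (fun n : ℕ => ∑ j ∈ Finset.Icc (-(m : ℤ)) (m : ℤ), (J y j) • e (j + n)) G
      (𝓝 (∑ j ∈ Finset.Icc (-(m : ℤ)) (m : ℤ), (J y j) • (0 : X))) :=
    tendsto_finsetSum _ fun j _ => (hG j).const_smul _
  simpa using this

theorem auxR_inv (hJinj : Function.Injective J)
    (he : ∀ n, J (e n) = Pi.single n (1 : 𝕜))
    (B : X → X) (hB : ∀ (x : X) (n : ℤ), J (B x) n = J x (n + 1))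
    (y : X) (hy : y ∈ auxD J) (n : ℕ) : B^[n] (auxR J e n y) = y := by
  obtain ⟨m, hm⟩ := hy
  rw [auxR_eq J e y m hm]
  apply hJinj
  ext k
  rw [aux_iter J B hB]
  conv_rhs => rw [auxD_eq J e hJinj he y m hm]
  simp only [map_sum, map_smul, he, Finset.sum_apply, Pi.smul_apply, Pi.single_apply]
  refine Finset.sum_congr rfl fun j _ => ?_
  congr 1
  exact if_congr (by omega) rfl rfl

end SingleSpace
theorem aux_iter_prod {X Y : Type*} (T : X → X) (S : Y → Y) (n : ℕ) (p : X × Y) :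
    (prodMap' T S)^[n] p = (T^[n] p.1, S^[n] p.2) := by
  induction n generalizing p with
  | zero => rfl
  | succ n ih => rw [Function.iterate_succ_apply, ih]; rfl

theorem aux_iter_pi {ι : Type*} {X : ι → Type*} (B : ∀ i, X i → X i) (n : ℕ) (x : ∀ i, X i) :
    (fun x : ∀ i, X i => fun i => B i (x i))^[n] x = fun i => (B i)^[n] (x i) := by
  induction n generalizing x with
  | zero => rfl
  | succ n ih => rw [Function.iterate_succ_apply, ih]; rfl

theorem aux_iter_add {X : Type*} [AddCommGroup X] (T : X → X) (hT : ∀ x y, T (x + y) = T x + T y)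
    (n : ℕ) (x y : X) : T^[n] (x + y) = T^[n] x + T^[n] y := by
  induction n generalizing x y with
  | zero => rfl
  | succ n ih => simp only [Function.iterate_succ_apply, hT, ih]

theorem aux_mix_trans {X : Type*} [TopologicalSpace X] (T : X → X) (F : Set (Set ℕ))
    (hF : IsFamily F) (h : FMix T F) : FTrans T F := by
  intro U V hU hV hUn hVn
  refine hF.2.1 (h (U ×ˢ U) (V ×ˢ V) (hU.prod hU) (hV.prod hV) (hUn.prod hUn) (hVn.prod hVn)) ?_
  rintro n ⟨p, hp, hq⟩
  rw [aux_iter_prod] at hq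
  exact ⟨p.1, hp.1, hq.1⟩

theorem aux_crit_trans {X : Type*} [TopologicalSpace X] [AddCommGroup X] [ContinuousAdd X]
    (T : X → X) (hT : ∀ x y, T (x + y) = T x + T y) (F : Set (Set ℕ))
    (hF : IsFamily F) (h : FMixCriterion T F) : FTrans T F := by
  obtain ⟨X₀, Y₀, hX, hY, S, hS⟩ := h
  intro U V hU hV hUn hVn
  obtain ⟨x, hxU, hx⟩ := hX.inter_open_nonempty U hU hUn
  obtain ⟨y, hyV, hy⟩ := hY.inter_open_nonempty V hV hVn
  have hc : Continuous (fun p : X × X × X => (x + p.2.1, p.1 + p.2.2)) := by fun_prop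
  have hO : (fun p : X × X × X => (x + p.2.1, p.1 + p.2.2)) ⁻¹' (U ×ˢ V) ∈
      𝓝 ((0, 0, y) : X × X × X) :=
    ((hU.prod hV).preimage hc).mem_nhds (by simp [hxU, hyV])
  refine hF.2.1 (hS x hx y hy _ hO) ?_
  rintro n ⟨h1, h2⟩
  refine ⟨x + S n y, h1, ?_⟩
  rw [aux_iter_add T hT]
  exact h2

theorem aux_filter_mix {X : Type*} [TopologicalSpace X] [AddCommGroup X] [ContinuousAdd X]
    (T : X → X) (hT : ∀ x y, T (x + y) = T x + T y) (F : Set (Set ℕ)) (hF : IsFamily F)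
    (G : Filter ℕ) (hG : ∀ s ∈ G, s ∈ F) (D : Set X) (hD : Dense D) (S : ℕ → X → X)
    (h1 : ∀ x ∈ D, Tendsto (fun n => T^[n] x) G (𝓝 0))
    (h2 : ∀ x ∈ D, Tendsto (fun n => S n x) G (𝓝 0))
    (h3 : ∀ x ∈ D, ∀ n, T^[n] (S n x) = x) : FMixCriterion T F ∧ FMix T F := by
  constructor
  · refine ⟨D, D, hD, hD, S, fun x hx y hy O hO => hG _ ?_⟩
    have := (h1 x hx).prodMk_nhds ((h2 y hy).prodMk_nhds (tendsto_const_nhds (x := y)))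
    filter_upwards [this hO] with n hn
    change (T^[n] x, S n y, T^[n] (S n y)) ∈ O
    rw [h3 y hy]
    exact hn
  · intro U V hU hV hUn hVn
    have hDD : Dense (D ×ˢ D) := hD.prod hD
    obtain ⟨x, hxU, hx⟩ := hDD.inter_open_nonempty U hU hUn
    obtain ⟨y, hyV, hy⟩ := hDD.inter_open_nonempty V hV hVn
    have t1 : Tendsto (fun n => (x.1 + S n y.1, x.2 + S n y.2)) G (𝓝 x) := by
      have := ((h2 _ hy.1).const_add x.1).prodMk_nhds ((h2 _ hy.2).const_add x.2)
      simpa using this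
    have t2 : Tendsto (fun n => (T^[n] x.1 + y.1, T^[n] x.2 + y.2)) G (𝓝 y) := by
      have := ((h1 _ hx.1).add_const y.1).prodMk_nhds ((h1 _ hx.2).add_const y.2)
      simpa using this
    refine hF.2.1 (hG _ (Filter.inter_mem (t1 (hU.mem_nhds hxU)) (t2 (hV.mem_nhds hyV)))) ?_
    rintro n ⟨a1, a2⟩
    refine ⟨_, a1, ?_⟩
    rw [aux_iter_prod]
    simp only [aux_iter_add T hT, h3 _ hy.1, h3 _ hy.2]
    exact a2

/-- The filter generated by the sets in condition (4). -/
def auxG {k : ℕ} {X : Fin k → Type} [∀ i, AddCommGroup (X i)] [∀ i, TopologicalSpace (X i)]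
    (e : ∀ i, ℤ → X i) : Filter ℕ where
  sets := {A | ∃ (N : ℕ) (W : ∀ i, Set (X i)), (∀ i, W i ∈ nhds (0 : X i)) ∧
        {n : ℕ | ∀ i, ∀ j : ℤ, |j| ≤ (N : ℤ) →
          e i (j + (n : ℤ)) ∈ W i ∧ e i (j - (n : ℤ)) ∈ W i} ⊆ A}
  univ_sets := ⟨0, fun _ => Set.univ, fun _ => Filter.univ_mem, Set.subset_univ _⟩
  sets_of_superset := by
    rintro A B ⟨N, W, hW, h⟩ hAB
    exact ⟨N, W, hW, h.trans hAB⟩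
  inter_sets := by
    rintro A B ⟨N, W, hW, h⟩ ⟨N', W', hW', h'⟩
    refine ⟨max N N', fun i => W i ∩ W' i, fun i => Filter.inter_mem (hW i) (hW' i), ?_⟩
    intro n hn
    refine ⟨h fun i j hj => ?_, h' fun i j hj => ?_⟩
    · have := hn i j (hj.trans (by exact_mod_cast le_max_left _ _))
      exact ⟨this.1.1, this.2.1⟩
    · have := hn i j (hj.trans (by exact_mod_cast le_max_right _ _))
      exact ⟨this.1.2, this.2.2⟩

theorem auxG_tendsto {k : ℕ} {X : Fin k → Type} [∀ i, AddCommGroup (X i)]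
    [∀ i, TopologicalSpace (X i)] (e : ∀ i, ℤ → X i) (i : Fin k) (j : ℤ) :
    Tendsto (fun n : ℕ => e i (j + n)) (auxG e) (𝓝 0) ∧
    Tendsto (fun n : ℕ => e i (j - n)) (auxG e) (𝓝 0) := by
  classical
  have key : ∀ W ∈ 𝓝 (0 : X i), {n : ℕ | e i (j + n) ∈ W ∧ e i (j - n) ∈ W} ∈ auxG e := by
    intro W hW
    refine ⟨j.natAbs, Function.update (fun _ => Set.univ) i W, fun i' => ?_, fun n hn => ?_⟩
    · by_cases h : i' = i
      · subst h; simpa using hW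
      · simp [h]
    · have := hn i j (by simp)
      simpa using this
  constructor
  · intro W hW
    rw [Filter.mem_map]
    exact Filter.mem_of_superset (key W hW) fun n hn => hn.1
  · intro W hW
    rw [Filter.mem_map]
    exact Filter.mem_of_superset (key W hW) fun n hn => hn.2

/-- Let `X₁, …, X_k` be bilateral Fréchet sequence spaces in which the
unit sequences `(e_n)_{n ∈ ℤ}` form a basis, and let `B_i` be the backward shift on
`X_i`. For a Furstenberg family `F`, the following are equivalent for
`T = B₁ ⊕ ⋯ ⊕ B_k`: (1) `T` is `F`-transitive; (2) `T` is `F`-mixing; (3) `T`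
satisfies the `F`-Mixing Criterion; (4) for every `N` and all neighborhoods `W_i` of
`0` in `X_i`, `{n : e_{j+n} ∈ W_i and e_{j−n} ∈ W_i for all |j| ≤ N, all i} ∈ F`. -/
theorem bilateral_backwardShift_fTransitive_tfae
    (𝕜 : Type) [RCLike 𝕜] (k : ℕ) (X : Fin k → Type)
    [∀ i, AddCommGroup (X i)] [∀ i, Module 𝕜 (X i)] [∀ i, UniformSpace (X i)]
    [∀ i, IsUniformAddGroup (X i)] [∀ i, ContinuousSMul 𝕜 (X i)] [∀ i, CompleteSpace (X i)]
    [∀ i, TopologicalSpace.MetrizableSpace (X i)]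
    [∀ i, TopologicalSpace.SeparableSpace (X i)]
    [∀ i, Module ℝ (X i)] [∀ i, IsScalarTower ℝ 𝕜 (X i)] [∀ i, LocallyConvexSpace ℝ (X i)]
    (hinf : ∀ i, ¬ FiniteDimensional 𝕜 (X i))
    -- the continuous injective embedding of `X i` into `𝕜^ℤ`
    (J : ∀ i, X i →L[𝕜] (ℤ → 𝕜)) (hJinj : ∀ i, Function.Injective (J i))
    -- the unit sequences, lying in each `X i`
    (e : ∀ i, ℤ → X i) (he : ∀ i n, J i (e i n) = Pi.single n (1 : 𝕜))
    -- `(e_n)_{n ∈ ℤ}` is a basis of each `X i`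
    (hbasis : ∀ i (x : X i),
      Filter.Tendsto (fun m : ℕ => ∑ n ∈ Finset.Icc (-(m : ℤ)) (m : ℤ), (J i x n) • e i n)
        Filter.atTop (nhds x))
    -- the backward shifts, mapping each `X i` to itself (hence continuous)
    (B : ∀ i, X i → X i) (hB : ∀ i (x : X i) (n : ℤ), J i (B i x) n = J i x (n + 1))
    (hBlin : ∀ i, IsLinearMap 𝕜 (B i)) (hBcont : ∀ i, Continuous (B i))
    (F : Set (Set ℕ)) (hF : IsFamily F) :
    (FTrans (fun x : ∀ i, X i => fun i => B i (x i)) F ↔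
      FMix (fun x : ∀ i, X i => fun i => B i (x i)) F) ∧
    (FMix (fun x : ∀ i, X i => fun i => B i (x i)) F ↔
      FMixCriterion (fun x : ∀ i, X i => fun i => B i (x i)) F) ∧
    (FMixCriterion (fun x : ∀ i, X i => fun i => B i (x i)) F ↔
      ∀ (N : ℕ) (W : ∀ i, Set (X i)), (∀ i, W i ∈ nhds (0 : X i)) →
        {n : ℕ | ∀ i, ∀ j : ℤ, |j| ≤ (N : ℤ) →
          e i (j + (n : ℤ)) ∈ W i ∧ e i (j - (n : ℤ)) ∈ W i} ∈ F) := by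
  have hT : ∀ x y : ∀ i, X i, (fun x : ∀ i, X i => fun i => B i (x i)) (x + y) =
      (fun x : ∀ i, X i => fun i => B i (x i)) x +
      (fun x : ∀ i, X i => fun i => B i (x i)) y := by
    intro x y
    funext i
    exact (hBlin i).map_add _ _
  have h21 := aux_mix_trans (fun x : ∀ i, X i => fun i => B i (x i)) F hF
  have h31 := aux_crit_trans (fun x : ∀ i, X i => fun i => B i (x i)) hT F hF
  have h14 : FTrans (fun x : ∀ i, X i => fun i => B i (x i)) F →
      ∀ (N : ℕ) (W : ∀ i, Set (X i)), (∀ i, W i ∈ nhds (0 : X i)) →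
        {n : ℕ | ∀ i, ∀ j : ℤ, |j| ≤ (N : ℤ) →
          e i (j + (n : ℤ)) ∈ W i ∧ e i (j - (n : ℤ)) ∈ W i} ∈ F := by
    intro h N W hW
    choose u v A hA C hC hAC using fun i => aux_main (J i) (e i) (hJinj i) (he i) (hbasis i)
      (B i) (hB i) (hBcont i) N (W i) (hW i)
    have hA' : Set.pi Set.univ A ∈ 𝓝 u := set_pi_mem_nhds Set.finite_univ fun i _ => hA i
    have hC' : Set.pi Set.univ C ∈ 𝓝 v := set_pi_mem_nhds Set.finite_univ fun i _ => hC i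
    refine hF.2.1 (h _ _ isOpen_interior isOpen_interior
      ⟨u, mem_interior_iff_mem_nhds.2 hA'⟩ ⟨v, mem_interior_iff_mem_nhds.2 hC'⟩) ?_
    rintro n ⟨x, hx, hy⟩ i j hj
    have hx' := interior_subset hx
    have hy' := interior_subset hy
    rw [aux_iter_pi] at hy'
    exact hAC i n (x i) (hx' i trivial) (hy' i trivial) j hj
  have h4 : (∀ (N : ℕ) (W : ∀ i, Set (X i)), (∀ i, W i ∈ nhds (0 : X i)) →
        {n : ℕ | ∀ i, ∀ j : ℤ, |j| ≤ (N : ℤ) →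
          e i (j + (n : ℤ)) ∈ W i ∧ e i (j - (n : ℤ)) ∈ W i} ∈ F) →
      FMixCriterion (fun x : ∀ i, X i => fun i => B i (x i)) F ∧
      FMix (fun x : ∀ i, X i => fun i => B i (x i)) F := by
    intro h
    refine aux_filter_mix _ hT F hF (auxG e) ?_ (Set.pi Set.univ fun i => auxD (J i))
      (dense_pi _ fun i _ => auxD_dense (J i) (e i) (he i) (hbasis i))
      (fun n y i => auxR (J i) (e i) n (y i)) ?_ ?_ ?_
    · rintro s ⟨N, W, hW, hs⟩
      exact hF.2.1 (h N W hW) hs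
    · intro x hx
      simp only [aux_iter_pi]
      rw [tendsto_pi_nhds]
      intro i
      exact aux_tendsto1 (J i) (e i) (hJinj i) (he i) (B i) (hB i) _
        (fun j => (auxG_tendsto e i j).2) (x i) (hx i trivial)
    · intro x hx
      rw [tendsto_pi_nhds]
      intro i
      exact aux_tendsto2 (J i) (e i) _
        (fun j => (auxG_tendsto e i j).1) (x i) (hx i trivial)
    · intro x hx n
      simp only [aux_iter_pi]
      funext i
      exact auxR_inv (J i) (e i) (hJinj i) (he i) (B i) (hB i) (x i) (hx i trivial) n
  exact ⟨⟨fun h => (h4 (h14 h)).2, h21⟩, ⟨fun h => (h4 (h14 (h21 h))).1,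
    fun h => (h4 (h14 (h31 h))).2⟩, ⟨fun h => h14 (h31 h), fun h => (h4 h).1⟩⟩
end

section
/- Let X₁, …, X_k be unilateral Fréchet sequence spaces (infinite-dimensional separable Fréchet spaces embedding continuously and injectively into the product space 𝕂^ℕ, 𝕂 = ℝ or ℂ) in which the coordinate unit vectors (e_n)_{n∈ℕ} form a basis, meaning that each e_n lies in X_i and for every x ∈ X_i the partial sums ∑_{n≤m} x_n e_n converge to x as m → ∞. Let B_i : X_i → X_i be the backward shift, (B_i x)_n = x_{n+1}, assumed to map X_i into X_i (hence continuous). Let F be a Furstenberg family. Then the following are equivalent: (1) B₁ ⊕ … ⊕ B_k is F-transitive; (2) B₁ ⊕ … ⊕ B_k is F-mixing; (3) B₁ ⊕ … ⊕ B_k satisfies the F-Mixing Criterion, i.e. there are dense subsets X₀, Y₀ of ⊕X_i and maps S_n : Y₀ → ⊕X_i with F-lim_{n→∞} (T^n x₀, S_n y₀, T^n S_n y₀) = (0,0,y₀) for all x₀ ∈ X₀, y₀ ∈ Y₀, where T = ⊕B_i; (4) for every N ∈ ℕ and every choice of neighborhoods W_i of 0 in X_i (1 ≤ i ≤ k), the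 set {n ∈ ℕ : e_{n+j} ∈ W_i for all j ≤ N and all 1 ≤ i ≤ k} belongs to F. -/
open Set Topology Function Filter
open scoped ENNReal

/- ### Helper lemmas -/

section Helpers

variable {𝕜 : Type} [RCLike 𝕜] {X : Type} [AddCommGroup X] [Module 𝕜 X]

lemma aux_tendsto_zero [UniformSpace X] [IsUniformAddGroup X] (J : X →L[𝕜] (ℕ → 𝕜)) (e : ℕ → X)
    (hbasis : ∀ x : X,
      Filter.Tendsto (fun m : ℕ => ∑ n ∈ Finset.range (m + 1), (J x n) • e n)
        Filter.atTop (nhds x)) (x : X) :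
    Tendsto (fun n => J x n • e n) atTop (𝓝 0) := by
  have h1 := (hbasis x).comp (tendsto_add_atTop_nat 1)
  have h2 := h1.sub (hbasis x)
  rw [sub_self] at h2
  rw [← tendsto_add_atTop_iff_nat 1]
  refine h2.congr fun n => ?_
  simp only [Function.comp]
  rw [Finset.sum_range_succ _ (n + 1), add_sub_cancel_left]

lemma aux_equicont [UniformSpace X] [IsUniformAddGroup X] [ContinuousSMul 𝕜 X] [CompleteSpace X]
    [TopologicalSpace.MetrizableSpace X] (J : X →L[𝕜] (ℕ → 𝕜)) (e : ℕ → X)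
    (hbasis : ∀ x : X,
      Filter.Tendsto (fun m : ℕ => ∑ n ∈ Finset.range (m + 1), (J x n) • e n)
        Filter.atTop (nhds x)) (W : Set X) (hW : W ∈ 𝓝 (0 : X)) :
    ∃ U ∈ 𝓝 (0 : X), ∀ x ∈ U, ∀ n, J x n • e n ∈ W := by
  have : (uniformity X).IsCountablyGenerated :=
    IsUniformAddGroup.uniformity_countably_generated
  have : BaireSpace X := inferInstance
  obtain ⟨W2, hW2, hsub⟩ : ∃ V ∈ 𝓝 (0 : X), ∀ v ∈ V, ∀ w ∈ V, v - w ∈ W := by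
    have hc : Tendsto (fun p : X × X => p.1 - p.2) (𝓝 (0, 0)) (𝓝 0) := by
      have : Continuous (fun p : X × X => p.1 - p.2) := by fun_prop
      simpa using this.tendsto (0, 0)
    have := hc hW
    rw [nhds_prod_eq, Filter.mem_map, Filter.mem_prod_self_iff] at this
    obtain ⟨V, hV, h⟩ := this
    exact ⟨V, hV, fun v hv w hw => h (Set.mk_mem_prod hv hw)⟩
  obtain ⟨W3, ⟨hW3, hW3c, hW3b⟩, hW32⟩ := (nhds_basis_closed_balanced 𝕜 X).mem_iff.1 hW2
  simp only [id] at hW32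
  let A : ℕ → Set X := fun m => {x | ∀ n, ((m : 𝕜) + 1)⁻¹ • (J x n • e n) ∈ W3}
  have hcont : ∀ n, Continuous fun x => J x n :=
    fun n => (continuous_apply n).comp J.continuous
  have hAc : ∀ m, IsClosed (A m) := by
    intro m
    simp only [A, Set.ofPred_forall]
    refine isClosed_iInter fun n => hW3c.preimage ?_
    exact ((hcont n).smul continuous_const).const_smul _
  have hne : ∀ m : ℕ, ((m : 𝕜) + 1) ≠ 0 := fun m => by exact_mod_cast Nat.succ_ne_zero m
  have hAU : ⋃ m, A m = univ := by
    rw [Set.eq_univ_iff_forall]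
    intro x
    have hb := (aux_tendsto_zero J e hbasis x).isVonNBounded_range 𝕜
    have ha := hb hW3
    have h1 : Tendsto (fun m : ℕ => ((m + 1 : ℕ) : 𝕜)) atTop (Bornology.cobounded 𝕜) :=
      tendsto_natCast_atTop_cobounded.comp (tendsto_add_atTop_nat 1)
    obtain ⟨m, hm⟩ := (h1.eventually ha).exists
    refine Set.mem_iUnion.2 ⟨m, fun n => ?_⟩
    have := hm (Set.mem_range_self n)
    push_cast at this
    exact (Set.mem_smul_set_iff_inv_smul_mem₀ (hne m) _ _).1 this
  obtain ⟨m, x0, hx0⟩ := nonempty_interior_of_iUnion_of_closed hAc hAU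
  refine ⟨{u | x0 + ((m : 𝕜) + 1) • u ∈ A m}, ?_, ?_⟩
  · have hc : Continuous fun u : X => x0 + ((m : 𝕜) + 1) • u := by fun_prop
    apply hc.continuousAt.preimage_mem_nhds
    simpa using mem_interior_iff_mem_nhds.1 hx0
  · intro u hu n
    have h1 := hW32 (hu n)
    have h2 := hW32 (interior_subset hx0 n)
    have h3 := hsub _ h1 _ h2
    convert h3 using 1
    rw [map_add, map_smul, ← smul_sub, ← sub_smul, Pi.add_apply, Pi.smul_apply, add_sub_cancel_left,
      smul_smul, smul_eq_mul, inv_mul_cancel_left₀ (hne m)]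

lemma aux_sum_small [TopologicalSpace X] [IsTopologicalAddGroup X] [ContinuousSMul 𝕜 X]
    (c : ℕ → 𝕜) (M : ℕ) :
    ∀ O ∈ 𝓝 (0 : X), ∃ W ∈ 𝓝 (0 : X), ∀ z : ℕ → X, (∀ m < M, z m ∈ W) →
      ∑ m ∈ Finset.range M, c m • z m ∈ O := by
  induction M with
  | zero => exact fun O hO => ⟨univ, univ_mem, fun z _ => by simpa using mem_of_mem_nhds hO⟩
  | succ M ih =>
    intro O hO
    obtain ⟨V, hV, h⟩ := exists_nhds_zero_half hO
    obtain ⟨W, hW, h'⟩ := ih V hV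
    have h2 : (fun x : X => c M • x) ⁻¹' V ∈ 𝓝 (0 : X) := by
      apply (continuous_const_smul (c M)).continuousAt.preimage_mem_nhds
      simpa using hV
    refine ⟨W ∩ _, inter_mem hW h2, fun z hz => ?_⟩
    rw [Finset.sum_range_succ]
    exact h _ (h' z fun m hm => (hz m (by omega)).1) _ (hz M (by omega)).2

lemma aux_J_iterate [TopologicalSpace X] (J : X →L[𝕜] (ℕ → 𝕜)) (B : X → X)
    (hB : ∀ (x : X) (n : ℕ), J (B x) n = J x (n + 1)) (n : ℕ) :
    ∀ (x : X) (m : ℕ), J (B^[n] x) m = J x (m + n) := by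
  induction n with
  | zero => intro x m; simp
  | succ n ih => intro x m; rw [Function.iterate_succ_apply, ih, hB]; rfl

lemma aux_J_sum [TopologicalSpace X] (J : X →L[𝕜] (ℕ → 𝕜)) (e : ℕ → X)
    (he : ∀ n, J (e n) = Pi.single n (1 : 𝕜)) (c : ℕ → 𝕜) (M n p : ℕ) :
    J (∑ m ∈ Finset.range M, c m • e (n + m)) (p + n) = if p < M then c p else 0 := by
  rw [map_sum, Finset.sum_apply]
  simp only [map_smul, he, Pi.smul_apply, Pi.single_apply, smul_eq_mul]
  have : ∀ m, (p + n = n + m) ↔ p = m := by intro m; omega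
  simp [this, Finset.sum_ite_eq]

lemma aux_T_iterate {k : ℕ} {X : Fin k → Type} (B : ∀ i, X i → X i) (n : ℕ) :
    ∀ (x : ∀ i, X i), (fun x : ∀ i, X i => fun i => B i (x i))^[n] x
      = fun i => (B i)^[n] (x i) := by
  induction n with
  | zero => intro x; rfl
  | succ n ih => intro x; rw [Function.iterate_succ_apply, ih]; rfl

lemma aux_lin_iterate (B : X → X) (hB : IsLinearMap 𝕜 B) (n : ℕ) :
    ∀ x y, B^[n] (x + y) = B^[n] x + B^[n] y := by
  induction n with
  | zero => intro x y; rfl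
  | succ n ih => intro x y; rw [Function.iterate_succ_apply, hB.map_add, ih]; rfl

lemma aux_prodMap_iterate {Y : Type*} (T : Y → Y) (n : ℕ) :
    ∀ p : Y × Y, (prodMap' T T)^[n] p = (T^[n] p.1, T^[n] p.2) := by
  induction n with
  | zero => intro p; rfl
  | succ n ih => intro p; rw [Function.iterate_succ_apply, ih]; rfl

end Helpers

/-- Condition (4) implies the key approximation property on finite sequences. -/
lemma aux_key {𝕜 : Type} [RCLike 𝕜] {k : ℕ} {X : Fin k → Type}
    [∀ i, AddCommGroup (X i)] [∀ i, Module 𝕜 (X i)] [∀ i, TopologicalSpace (X i)]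
    [∀ i, IsTopologicalAddGroup (X i)] [∀ i, ContinuousSMul 𝕜 (X i)]
    (J : ∀ i, X i →L[𝕜] (ℕ → 𝕜)) (hJinj : ∀ i, Function.Injective (J i))
    (e : ∀ i, ℕ → X i) (he : ∀ i n, J i (e i n) = Pi.single n (1 : 𝕜))
    (B : ∀ i, X i → X i) (hB : ∀ i (x : X i) (n : ℕ), J i (B i x) n = J i x (n + 1))
    (F : Set (Set ℕ)) (hF : IsFamily F)
    (h4 : ∀ (N : ℕ) (W : ∀ i, Set (X i)), (∀ i, W i ∈ nhds (0 : X i)) →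
        {n : ℕ | ∀ i, ∀ j ≤ N, e i (n + j) ∈ W i} ∈ F)
    (M : ℕ) (y y' : ∀ i, X i)
    (O : Set (∀ i, X i)) (hO : O ∈ 𝓝 (0 : ∀ i, X i)) :
    {n : ℕ | (∀ x : ∀ i, X i, (∀ i, ∀ m ≥ M, J i (x i) m = 0) →
          (fun x : ∀ i, X i => fun i => B i (x i))^[n] x = 0) ∧
      (fun i => ∑ m ∈ Finset.range M, J i (y i) m • e i (n + m)) ∈ O ∧
      (fun i => ∑ m ∈ Finset.range M, J i (y' i) m • e i (n + m)) ∈ O} ∈ F := by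
  rw [nhds_pi, Filter.mem_pi] at hO
  obtain ⟨I, -, t, ht, htO⟩ := hO
  choose W hW hWs using fun i => aux_sum_small (J i (y i)) M (t i) (ht i)
  choose W' hW' hWs' using fun i => aux_sum_small (J i (y' i)) M (t i) (ht i)
  let D : ∀ i, Set (X i) := fun i => ⋂ m ∈ Finset.range M, {z | ‖J i z m‖ < 1}
  have hD : ∀ i, D i ∈ 𝓝 (0 : X i) := by
    intro i
    refine (Filter.biInter_finset_mem _).2 fun m _ => ?_
    have hc : Continuous fun z : X i => ‖J i z m‖ :=
      ((continuous_apply m).comp (J i).continuous).norm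
    exact (isOpen_lt hc continuous_const).mem_nhds (by simp)
  refine hF.2.1 (h4 M (fun i => W i ∩ W' i ∩ D i)
    fun i => inter_mem (inter_mem (hW i) (hW' i)) (hD i)) fun n hn => ⟨?_, ?_, ?_⟩
  · intro x hx
    rw [aux_T_iterate]
    funext i
    apply hJinj i
    funext m
    rw [aux_J_iterate (J i) (B i) (hB i)]
    have hMn : M ≤ n := by
      by_contra hlt
      have h1 := (hn i 0 (Nat.zero_le _)).2
      have h2 := Set.mem_iInter₂.1 h1 n (Finset.mem_range.2 (by omega))
      simp [he] at h2
    rw [hx i _ (by omega)]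
    simp
  · exact htO fun i _ => hWs i _ fun m hm => (hn i m hm.le).1.1
  · exact htO fun i _ => hWs' i _ fun m hm => (hn i m hm.le).1.2

/-- Let `X₁, …, X_k` be unilateral Fréchet sequence spaces in which the
unit sequences `(e_n)_{n ∈ ℕ}` form a basis, and let `B_i` be the backward shift on
`X_i`. For a Furstenberg family `F`, the following are equivalent for
`T = B₁ ⊕ ⋯ ⊕ B_k`: (1) `T` is `F`-transitive; (2) `T` is `F`-mixing; (3) `T`
satisfies the `F`-Mixing Criterion; (4) for every `N` and all neighborhoods `W_i` of
`0` in `X_i`, `{n : e_{n+j} ∈ W_i for all j ≤ N and all i} ∈ F`. -/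
theorem unilateral_backwardShift_fTransitive_tfae
    (𝕜 : Type) [RCLike 𝕜] (k : ℕ) (X : Fin k → Type)
    [∀ i, AddCommGroup (X i)] [∀ i, Module 𝕜 (X i)] [∀ i, UniformSpace (X i)]
    [∀ i, IsUniformAddGroup (X i)] [∀ i, ContinuousSMul 𝕜 (X i)] [∀ i, CompleteSpace (X i)]
    [∀ i, TopologicalSpace.MetrizableSpace (X i)]
    [∀ i, TopologicalSpace.SeparableSpace (X i)]
    [∀ i, Module ℝ (X i)] [∀ i, IsScalarTower ℝ 𝕜 (X i)] [∀ i, LocallyConvexSpace ℝ (X i)]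
    (hinf : ∀ i, ¬ FiniteDimensional 𝕜 (X i))
    -- the continuous injective embedding of `X i` into `𝕜^ℕ`
    (J : ∀ i, X i →L[𝕜] (ℕ → 𝕜)) (hJinj : ∀ i, Function.Injective (J i))
    -- the unit sequences, lying in each `X i`
    (e : ∀ i, ℕ → X i) (he : ∀ i n, J i (e i n) = Pi.single n (1 : 𝕜))
    -- `(e_n)_{n ∈ ℕ}` is a basis of each `X i`
    (hbasis : ∀ i (x : X i),
      Filter.Tendsto (fun m : ℕ => ∑ n ∈ Finset.range (m + 1), (J i x n) • e i n)
        Filter.atTop (nhds x))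
    -- the backward shifts, mapping each `X i` to itself (hence continuous)
    (B : ∀ i, X i → X i) (hB : ∀ i (x : X i) (n : ℕ), J i (B i x) n = J i x (n + 1))
    (hBlin : ∀ i, IsLinearMap 𝕜 (B i)) (hBcont : ∀ i, Continuous (B i))
    (F : Set (Set ℕ)) (hF : IsFamily F) :
    (FTrans (fun x : ∀ i, X i => fun i => B i (x i)) F ↔
      FMix (fun x : ∀ i, X i => fun i => B i (x i)) F) ∧
    (FMix (fun x : ∀ i, X i => fun i => B i (x i)) F ↔
      FMixCriterion (fun x : ∀ i, X i => fun i => B i (x i)) F) ∧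
    (FMixCriterion (fun x : ∀ i, X i => fun i => B i (x i)) F ↔
      ∀ (N : ℕ) (W : ∀ i, Set (X i)), (∀ i, W i ∈ nhds (0 : X i)) →
        {n : ℕ | ∀ i, ∀ j ≤ N, e i (n + j) ∈ W i} ∈ F) := by
  set T : (∀ i, X i) → (∀ i, X i) := fun x i => B i (x i) with hT
  let P : (∀ i, X i) → ℕ → Prop := fun y M => ∀ i, ∀ m ≥ M, J i (y i) m = 0
  let Sf : ℕ → ℕ → (∀ i, X i) → (∀ i, X i) := fun M n y i =>
    ∑ m ∈ Finset.range M, J i (y i) m • e i (n + m)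
  have hTadd : ∀ n x y, T^[n] (x + y) = T^[n] x + T^[n] y := by
    intro n x y
    rw [hT, aux_T_iterate, aux_T_iterate, aux_T_iterate]
    funext i
    exact aux_lin_iterate (B i) (hBlin i) n _ _
  have hTS : ∀ M n y, P y M → T^[n] (Sf M n y) = y := by
    intro M n y hy
    rw [hT, aux_T_iterate]
    funext i
    apply hJinj i
    funext p
    rw [aux_J_iterate (J i) (B i) (hB i), aux_J_sum (J i) (e i) (he i)]
    split_ifs with h
    · rfl
    · exact (hy i p (by omega)).symm
  have hPmono : ∀ y M M', M ≤ M' → P y M → P y M' := fun y M M' h hy i m hm =>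
    hy i m (le_trans h hm)
  have hdense : Dense {y | ∃ M, P y M} := by
    intro y
    refine mem_closure_of_tendsto (f := fun m : ℕ => fun i =>
      ∑ n ∈ Finset.range (m + 1), (J i (y i) n) • e i n) (b := atTop)
      (tendsto_pi_nhds.2 fun i => hbasis i (y i)) (Eventually.of_forall fun m => ?_)
    refine ⟨m + 1, fun i p hp => ?_⟩
    have := aux_J_sum (J i) (e i) (he i) (J i (y i)) (m + 1) 0 p
    simp only [zero_add, add_zero] at this
    rw [this, if_neg (by omega)]
  have h21 : FMix T F → FTrans T F := by
    intro h U V hU hV hUn hVn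
    refine hF.2.1 (h (U ×ˢ univ) (V ×ˢ univ) (hU.prod isOpen_univ) (hV.prod isOpen_univ)
      (hUn.prod univ_nonempty) (hVn.prod univ_nonempty)) ?_
    rintro n ⟨p, hp, hp'⟩
    rw [aux_prodMap_iterate] at hp'
    exact ⟨p.1, hp.1, hp'.1⟩
  have h31 : FMixCriterion T F → FTrans T F := by
    rintro ⟨X₀, Y₀, hX, hY, S, hS⟩ U V hU hV hUn hVn
    obtain ⟨x, hxU, hx⟩ := hX.inter_open_nonempty U hU hUn
    obtain ⟨y, hyV, hy⟩ := hY.inter_open_nonempty V hV hVn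
    have hO : {q : (∀ i, X i) × (∀ i, X i) × (∀ i, X i) | x + q.2.1 ∈ U ∧ q.1 + q.2.2 ∈ V} ∈
        nhds ((0, 0, y) : (∀ i, X i) × (∀ i, X i) × (∀ i, X i)) := by
      refine IsOpen.mem_nhds ?_ ?_
      · exact (hU.preimage (by fun_prop : Continuous fun q : (∀ i, X i) × (∀ i, X i) × (∀ i, X i) =>
          x + q.2.1)).inter (hV.preimage (by fun_prop :
            Continuous fun q : (∀ i, X i) × (∀ i, X i) × (∀ i, X i) => q.1 + q.2.2))
      · simpa using ⟨hxU, hyV⟩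
    refine hF.2.1 (hS x hx y hy _ hO) fun n hn => ⟨x + S n y, hn.1, ?_⟩
    rw [hTadd]
    exact hn.2
  have h14 : FTrans T F → ∀ (N : ℕ) (W : ∀ i, Set (X i)), (∀ i, W i ∈ nhds (0 : X i)) →
        {n : ℕ | ∀ i, ∀ j ≤ N, e i (n + j) ∈ W i} ∈ F := by
    intro h N W hW
    have hW' : ∀ i, ∃ W' ∈ 𝓝 (0 : X i), Balanced 𝕜 W' ∧ W' ⊆ W i := by
      intro i
      obtain ⟨W', ⟨h1, h2⟩, h3⟩ := (nhds_basis_balanced 𝕜 (X i)).mem_iff.1 (hW i)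
      exact ⟨W', h1, h2, h3⟩
    choose W' hW' hbal hsub using hW'
    have hU : ∀ i, ∃ U ∈ 𝓝 (0 : X i), ∀ x ∈ U, ∀ n, J i x n • e i n ∈
        (fun z : X i => (2 : 𝕜) • z) ⁻¹' W' i := by
      intro i
      refine aux_equicont (J i) (e i) (hbasis i) _ ?_
      apply (continuous_const_smul (2 : 𝕜)).continuousAt.preimage_mem_nhds
      simpa using hW' i
    choose U hU hUe using hU
    let V : Set (∀ i, X i) := ⋂ i, ⋂ j ∈ Finset.range (N + 1), {y | 1 / 2 < ‖J i (y i) j‖}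
    have hV : IsOpen V := by
      refine isOpen_iInter_of_finite fun i => isOpen_biInter_finset fun j _ => ?_
      exact isOpen_lt continuous_const
        (((continuous_apply j).comp ((J i).continuous.comp (continuous_apply i))).norm)
    have hVn : V.Nonempty := by
      refine ⟨fun i => ∑ m ∈ Finset.range (N + 1), (1 : 𝕜) • e i (0 + m), ?_⟩
      refine Set.mem_iInter.2 fun i => Set.mem_iInter₂.2 fun j hj => ?_
      have := aux_J_sum (J i) (e i) (he i) (fun _ => 1) (N + 1) 0 j
      rw [add_zero, if_pos (Finset.mem_range.1 hj)] at this
      rw [Set.mem_ofPred_eq, this]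
      norm_num
    have hUU : Set.pi univ U ∈ 𝓝 (0 : ∀ i, X i) := set_pi_mem_nhds finite_univ fun i _ => hU i
    refine hF.2.1 (h (interior (Set.pi univ U)) V isOpen_interior hV
      ⟨0, mem_interior_iff_mem_nhds.2 hUU⟩ hVn) ?_
    rintro n ⟨x, hx, hxV⟩ i j hj
    have hx' := interior_subset hx i (mem_univ i)
    have h1 := hUe i _ hx' (n + j)
    have h2 := Set.mem_iInter₂.1 (Set.mem_iInter.1 hxV i) j (Finset.mem_range.2 (by omega))
    rw [Set.mem_ofPred_eq, hT, aux_T_iterate, aux_J_iterate (J i) (B i) (hB i), add_comm j n] at h2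
    apply hsub i
    set c := J i (x i) (n + j) with hc
    have hc0 : c ≠ 0 := by
      intro h0
      rw [h0, norm_zero] at h2
      norm_num at h2
    have h3 : (2 * c)⁻¹ • ((2 : 𝕜) • (c • e i (n + j))) ∈ W' i := by
      refine (hbal i).smul_mem ?_ h1
      rw [norm_inv, norm_mul, RCLike.norm_ofNat]
      apply inv_le_one_of_one_le₀
      linarith
    rwa [smul_smul, smul_smul, mul_assoc, inv_mul_cancel₀ (by simpa using hc0), one_smul] at h3
  have h42 : (∀ (N : ℕ) (W : ∀ i, Set (X i)), (∀ i, W i ∈ nhds (0 : X i)) →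
        {n : ℕ | ∀ i, ∀ j ≤ N, e i (n + j) ∈ W i} ∈ F) → FMix T F := by
    intro h4 U V hU hV hUn hVn
    obtain ⟨⟨x, x'⟩, hxU, ⟨M1, h1⟩, ⟨M2, h2⟩⟩ :=
      (hdense.prod hdense).inter_open_nonempty U hU hUn
    obtain ⟨⟨y, y'⟩, hyV, ⟨M3, h3⟩, ⟨M4, h4'⟩⟩ :=
      (hdense.prod hdense).inter_open_nonempty V hV hVn
    simp only at h1 h2 h3 h4'
    obtain ⟨M, hM1, hM2, hM3, hM4⟩ : ∃ M, M1 ≤ M ∧ M2 ≤ M ∧ M3 ≤ M ∧ M4 ≤ M :=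
      ⟨M1 + M2 + M3 + M4, by omega, by omega, by omega, by omega⟩
    have hpre : {q : (∀ i, X i) × (∀ i, X i) | (x + q.1, x' + q.2) ∈ U} ∈
        𝓝 ((0, 0) : (∀ i, X i) × (∀ i, X i)) := by
      refine IsOpen.mem_nhds (hU.preimage (by fun_prop)) ?_
      simpa using hxU
    rw [nhds_prod_eq, Filter.mem_prod_self_iff] at hpre
    obtain ⟨O, hO, hOU⟩ := hpre
    refine hF.2.1 (aux_key J hJinj e he B hB F hF h4 M y y' O hO) ?_
    rintro n ⟨hn1, hn2, hn3⟩
    refine ⟨(x + Sf M n y, x' + Sf M n y'), hOU (Set.mk_mem_prod hn2 hn3), ?_⟩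
    rw [aux_prodMap_iterate]
    simp only
    rw [hTadd, hTadd, hTS M n y (hPmono _ _ _ hM3 h3), hTS M n y' (hPmono _ _ _ hM4 h4'),
      hT, hn1 x (hPmono _ _ _ hM1 h1), hn1 x' (hPmono _ _ _ hM2 h2), zero_add, zero_add]
    exact hyV
  have h43 : (∀ (N : ℕ) (W : ∀ i, Set (X i)), (∀ i, W i ∈ nhds (0 : X i)) →
        {n : ℕ | ∀ i, ∀ j ≤ N, e i (n + j) ∈ W i} ∈ F) → FMixCriterion T F := by
    intro h4
    classical
    refine ⟨_, _, hdense, hdense, fun n y => if h : ∃ M, P y M then Sf (Nat.find h) n y else 0, ?_⟩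
    rintro x ⟨M1, hx⟩ y hy O hO
    replace hy : ∃ M, P y M := hy
    -- enlarging the cutoff does not change the forward shift
    have hSf : ∀ M n, Nat.find hy ≤ M → Sf M n y = Sf (Nat.find hy) n y := by
      intro M n hM
      funext i
      refine (Finset.sum_subset (Finset.range_mono hM) fun m _ hm => ?_).symm
      rw [Nat.find_spec hy i m (by simpa using hm), zero_smul]
    have hpre : (fun z : ∀ i, X i => ((0, z, y) : (∀ i, X i) × (∀ i, X i) × (∀ i, X i))) ⁻¹' O ∈
        𝓝 (0 : ∀ i, X i) :=
      ContinuousAt.preimage_mem_nhds (by fun_prop) hO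
    refine hF.2.1 (aux_key J hJinj e he B hB F hF h4 (M1 + Nat.find hy) y y _ hpre) ?_
    rintro n ⟨hn1, hn2, -⟩
    have e1 := hn1 x (hPmono x _ _ (by omega) hx)
    have e2 : Sf (M1 + Nat.find hy) n y = Sf (Nat.find hy) n y := hSf _ n (by omega)
    have e3 := hTS _ n y (Nat.find_spec hy)
    change (0, Sf (M1 + Nat.find hy) n y, y) ∈ O at hn2
    rw [e2] at hn2
    change (T^[n] x, _, _) ∈ O
    have e4 : (if h : ∃ M, P y M then Sf (Nat.find h) n y else 0) = Sf (Nat.find hy) n y :=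
      dif_pos hy
    have e5 : T^[n] x = 0 := e1
    beta_reduce
    rw [e4, e3, e5]
    exact hn2
  exact ⟨⟨fun h => h42 (h14 h), h21⟩, ⟨fun h => h43 (h14 (h21 h)), fun h => h42 (h14 (h31 h))⟩,
    ⟨fun h => h14 (h31 h), h43⟩⟩
end
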